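/- Let X be the ℂ-subalgebra of Maps(SL(2,ℂ)^4, ℂ) generated by the fifteen trace functions t_{i1⋯ir} for 1 ≤ i1 < ⋯ < ir ≤ 4, and let A = {1, t13, t24, t13·t24} ∪ {t13^k, t13^k·t24, t24^k, t24^k·t13 : k ≥ 2} ∪ {t13^k·t123, t13^k·t134, t24^k·t124, t24^k·t234 : k ≥ 0}. Then the family B = {t1^{i1}·t2^{i2}·t3^{i3}·t4^{i4}·t12^{i5}·t23^{i6}·t34^{i7}·t14^{i8}·a : i1,…,i8 ≥ 0, a ∈ A} is a basis of X as a vector space over ℂ. -/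

import Mathlib

/-- The 2×2 complex matrices. -/
abbrev M2 : Type := Matrix (Fin 2) (Fin 2) ℂ

/-- The group SL(2,ℂ). -/
abbrev SL2 : Type := Matrix.SpecialLinearGroup (Fin 2) ℂ

/-- The trace function `t_i` on quadruples in SL(2,ℂ): `ρ ↦ tr(ρ_i)`.
(Indices are 0-based: `tr1 0` is `t₁`, ..., `tr1 3` is `t₄`.) -/
noncomputable def tr1 (i : Fin 4) : (Fin 4 → SL2) → ℂ :=
  fun ρ => Matrix.trace (ρ i : M2)

/-- The trace function `t_{ij}` on quadruples in SL(2,ℂ): `ρ ↦ tr(ρ_i·ρ_j)`. -/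
noncomputable def tr2 (i j : Fin 4) : (Fin 4 → SL2) → ℂ :=
  fun ρ => Matrix.trace ((ρ i : M2) * (ρ j : M2))

/-- The trace function `t_{ijk}` on quadruples in SL(2,ℂ): `ρ ↦ tr(ρ_i·ρ_j·ρ_k)`. -/
noncomputable def tr3 (i j k : Fin 4) : (Fin 4 → SL2) → ℂ :=
  fun ρ => Matrix.trace ((ρ i : M2) * (ρ j : M2) * (ρ k : M2))

/-- The trace function `t₁₂₃₄` on quadruples in SL(2,ℂ): `ρ ↦ tr(ρ₁·ρ₂·ρ₃·ρ₄)`. -/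
noncomputable def tr4 : (Fin 4 → SL2) → ℂ :=
  fun ρ => Matrix.trace ((ρ 0 : M2) * (ρ 1 : M2) * (ρ 2 : M2) * (ρ 3 : M2))

/-- The ℂ-subalgebra `X` of functions SL(2,ℂ)⁴ → ℂ generated by the fifteen trace
functions `t_{i₁⋯i_r}`, `1 ≤ i₁ < ⋯ < i_r ≤ 4`; it is the coordinate ring of the
SL(2,ℂ)-character variety of the rank 4 free group. -/
noncomputable def Xalg : Subalgebra ℂ ((Fin 4 → SL2) → ℂ) :=
  Algebra.adjoin ℂ
    {f | (∃ i, f = tr1 i) ∨ (∃ i j, i < j ∧ f = tr2 i j) ∨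
      (∃ i j k, i < j ∧ j < k ∧ f = tr3 i j k) ∨ f = tr4}

/-- The ℂ-subalgebra `Q` generated by t₁, t₂, t₃, t₄, t₁₂, t₂₃, t₃₄, t₁₄. -/
noncomputable def Qalg : Subalgebra ℂ ((Fin 4 → SL2) → ℂ) :=
  Algebra.adjoin ℂ
    {tr1 0, tr1 1, tr1 2, tr1 3, tr2 0 1, tr2 1 2, tr2 2 3, tr2 0 3}

/-- The set `A = {1, t₁₃, t₂₄, t₁₃t₂₄} ∪ {t₁₃ᵏ, t₁₃ᵏt₂₄, t₂₄ᵏ, t₂₄ᵏt₁₃ : k ≥ 2}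
∪ {t₁₃ᵏt₁₂₃, t₁₃ᵏt₁₃₄, t₂₄ᵏt₁₂₄, t₂₄ᵏt₂₃₄ : k ≥ 0}`. -/
noncomputable def Aset : Set ((Fin 4 → SL2) → ℂ) :=
  {1, tr2 0 2, tr2 1 3, tr2 0 2 * tr2 1 3} ∪
  {f | ∃ k : ℕ, 2 ≤ k ∧ (f = tr2 0 2 ^ k ∨ f = tr2 0 2 ^ k * tr2 1 3 ∨
    f = tr2 1 3 ^ k ∨ f = tr2 1 3 ^ k * tr2 0 2)} ∪
  {f | ∃ k : ℕ, f = tr2 0 2 ^ k * tr3 0 1 2 ∨ f = tr2 0 2 ^ k * tr3 0 2 3 ∨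
    f = tr2 1 3 ^ k * tr3 0 1 3 ∨ f = tr2 1 3 ^ k * tr3 1 2 3}

/-- The family `B = {t₁^{i₁}t₂^{i₂}t₃^{i₃}t₄^{i₄}t₁₂^{i₅}t₂₃^{i₆}t₃₄^{i₇}t₁₄^{i₈}·a}`,
indexed by exponent vectors `(i₁,…,i₈)` and elements `a ∈ A`. -/
noncomputable def Bfam : ((Fin 8 → ℕ) × Aset) → ((Fin 4 → SL2) → ℂ) :=
  fun p => tr1 0 ^ p.1 0 * tr1 1 ^ p.1 1 * tr1 2 ^ p.1 2 * tr1 3 ^ p.1 3 *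
    tr2 0 1 ^ p.1 4 * tr2 1 2 ^ p.1 5 * tr2 2 3 ^ p.1 6 * tr2 0 3 ^ p.1 7 * (p.2 : _)


set_option linter.all false

namespace S6

open Filter Topology MvPolynomial

abbrev Fn : Type := (Fin 4 → SL2) → ℂ

noncomputable def mkSL (M : M2) : SL2 :=
  open Classical in if h : M.det = 1 then ⟨M, h⟩ else 1

lemma mkSL_coe (M : M2) (h : M.det = 1) : (mkSL M : M2) = M := by
  simp [mkSL, h]

/-- The degenerating family of quadruples. -/
noncomputable def path (p w p' w' a b e f : ℂ) (ε : ℂ) : Fin 4 → SL2 :=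
  ![mkSL !![p, (p * w - 1) * ε; ε⁻¹, w],
    mkSL !![a, 0; 0, a⁻¹],
    mkSL !![p', ε⁻¹; (p' * w' - 1) * ε, w'],
    mkSL !![b, e * ε; f * ε, (1 + e * f * ε ^ 2) * b⁻¹]]

section
variable (p w p' w' a b e f : ℂ) {ε : ℂ}

lemma path0 (hε : ε ≠ 0) : (path p w p' w' a b e f ε 0 : M2) =
    !![p, (p * w - 1) * ε; ε⁻¹, w] := by
  apply mkSL_coe
  rw [Matrix.det_fin_two_of]; field_simp; ring

lemma path1 (ha : a ≠ 0) : (path p w p' w' a b e f ε 1 : M2) = !![a, 0; 0, a⁻¹] := by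
  apply mkSL_coe
  rw [Matrix.det_fin_two_of]; field_simp; ring

lemma path2 (hε : ε ≠ 0) : (path p w p' w' a b e f ε 2 : M2) =
    !![p', ε⁻¹; (p' * w' - 1) * ε, w'] := by
  apply mkSL_coe
  rw [Matrix.det_fin_two_of]; field_simp; ring

lemma path3 (hb : b ≠ 0) : (path p w p' w' a b e f ε 3 : M2) =
    !![b, e * ε; f * ε, (1 + e * f * ε ^ 2) * b⁻¹] := by
  apply mkSL_coe
  rw [Matrix.det_fin_two_of]; field_simp; ring
end

/-- `g` has leading coefficient `L` at order `n` along the path. -/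
def HasLead (π : ℂ → Fin 4 → SL2) (n : ℕ) (g : Fn) (L : ℂ) : Prop :=
  Tendsto (fun ε : ℂ => ε ^ (2 * n) * g (π ε)) (𝓝[≠] 0) (𝓝 L)

lemma HasLead.mul {π : ℂ → Fin 4 → SL2} {n m : ℕ} {g h : Fn} {L M : ℂ}
    (hg : HasLead π n g L) (hh : HasLead π m h M) : HasLead π (n + m) (g * h) (L * M) := by
  refine (Tendsto.mul hg hh).congr fun ε => ?_
  simp only [Pi.mul_apply]; ring

lemma HasLead.add {π : ℂ → Fin 4 → SL2} {n : ℕ} {g h : Fn} {L M : ℂ}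
    (hg : HasLead π n g L) (hh : HasLead π n h M) : HasLead π n (g + h) (L + M) := by
  refine (Tendsto.add hg hh).congr fun ε => ?_
  simp only [Pi.add_apply]; ring

lemma HasLead.one {π : ℂ → Fin 4 → SL2} : HasLead π 0 1 1 := by
  simp [HasLead]

lemma HasLead.zero {π : ℂ → Fin 4 → SL2} {n : ℕ} : HasLead π n 0 0 := by
  simp [HasLead]

lemma HasLead.pow {π : ℂ → Fin 4 → SL2} {n : ℕ} {g : Fn} {L : ℂ}
    (hg : HasLead π n g L) (k : ℕ) : HasLead π (k * n) (g ^ k) (L ^ k) := by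
  induction k with
  | zero => simpa using HasLead.one
  | succ k ih =>
    rw [pow_succ, pow_succ, Nat.succ_mul]
    exact ih.mul hg

lemma HasLead.raise {π : ℂ → Fin 4 → SL2} {n m : ℕ} {g : Fn} {L : ℂ}
    (hg : HasLead π n g L) (h : n < m) : HasLead π m g 0 := by
  have h1 : Tendsto (fun ε : ℂ => ε ^ (2 * (m - n))) (𝓝[≠] 0) (𝓝 0) := by
    have : Continuous fun ε : ℂ => ε ^ (2 * (m - n)) := by fun_prop
    have h2 := this.tendsto 0
    rw [zero_pow (by omega)] at h2
    exact h2.mono_left nhdsWithin_le_nhds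
  have h3 := h1.mul hg
  rw [zero_mul] at h3
  refine h3.congr fun ε => ?_
  rw [← mul_assoc, ← pow_add]
  congr 2; omega

lemma HasLead.unique {π : ℂ → Fin 4 → SL2} {n : ℕ} {g : Fn} {L M : ℂ}
    (hg : HasLead π n g L) (hh : HasLead π n g M) : L = M :=
  tendsto_nhds_unique hg hh

lemma HasLead.of_cont {π : ℂ → Fin 4 → SL2} {n : ℕ} {g : Fn} {L : ℂ} (P : ℂ → ℂ)
    (hP : Continuous P) (h0 : P 0 = L) (h : ∀ ε, ε ≠ 0 → ε ^ (2 * n) * g (π ε) = P ε) :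
    HasLead π n g L := by
  have h2 := (hP.tendsto 0).mono_left (nhdsWithin_le_nhds (s := {0}ᶜ))
  rw [h0] at h2
  refine h2.congr' ?_
  filter_upwards [self_mem_nhdsWithin] with ε hε
  exact (h ε hε).symm

section leads
variable (p w p' w' a b e f : ℂ) (ha : a ≠ 0) (hb : b ≠ 0)
include ha hb

lemma lead_x : HasLead (path p w p' w' a b e f) 1 (tr2 0 2) 1 := by
  refine HasLead.of_cont (fun ε => ε ^ 2 * (p * p' + (p * w - 1) * (p' * w' - 1) * ε ^ 2 + w * w') + 1)
    (by fun_prop) (by simp) fun ε hε => ?_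
  simp only [tr2, path0 p w p' w' a b e f hε, path2 p w p' w' a b e f hε,
    Matrix.trace_fin_two, Matrix.mul_apply, Fin.sum_univ_two]
  simp; field_simp; ring

lemma lead_z : HasLead (path p w p' w' a b e f) 0 (tr2 1 3) (a * b + a⁻¹ * b⁻¹) := by
  refine HasLead.of_cont (fun ε => a * b + a⁻¹ * ((1 + e * f * ε ^ 2) * b⁻¹))
    (by fun_prop) (by simp) fun ε hε => ?_
  simp only [tr2, path1 p w p' w' a b e f ha, path3 p w p' w' a b e f hb,
    Matrix.trace_fin_two, Matrix.mul_apply, Fin.sum_univ_two]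
  simp

lemma lead_123 : HasLead (path p w p' w' a b e f) 1 (tr3 0 1 2) a := by
  refine HasLead.of_cont (fun ε => ε ^ 2 * (p * a * p' + (p * w - 1) * (p' * w' - 1) * ε ^ 2 * a⁻¹
      + w * w' * a⁻¹) + a)
    (by fun_prop) (by simp) fun ε hε => ?_
  simp only [tr3, path0 p w p' w' a b e f hε, path1 p w p' w' a b e f ha,
    path2 p w p' w' a b e f hε,
    Matrix.trace_fin_two, Matrix.mul_apply, Fin.sum_univ_two]
  simp; field_simp; ring

lemma lead_134 : HasLead (path p w p' w' a b e f) 1 (tr3 0 2 3) b⁻¹ := by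
  refine HasLead.of_cont (fun ε => ε ^ 2 * ((p * p' + (p * w - 1) * (p' * w' - 1) * ε ^ 2) * b
      + (p + (p * w - 1) * ε ^ 2 * w') * f + (p' + w * (p' * w' - 1) * ε ^ 2) * e)
      + (1 + ε ^ 2 * (w * w')) * ((1 + e * f * ε ^ 2) * b⁻¹))
    (by fun_prop) (by simp) fun ε hε => ?_
  simp only [tr3, path0 p w p' w' a b e f hε, path3 p w p' w' a b e f hb,
    path2 p w p' w' a b e f hε,
    Matrix.trace_fin_two, Matrix.mul_apply, Fin.sum_univ_two]
  simp; field_simp; ring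

lemma lead_124 : HasLead (path p w p' w' a b e f) 0 (tr3 0 1 3)
    (p * a * b + a * e + w * a⁻¹ * b⁻¹) := by
  refine HasLead.of_cont (fun ε => p * a * b + (p * w - 1) * ε ^ 2 * a⁻¹ * f + a * e +
     w * a⁻¹ * ((1 + e * f * ε ^ 2) * b⁻¹))
    (by fun_prop) (by simp; try ring) fun ε hε => ?_
  simp only [tr3, path0 p w p' w' a b e f hε, path1 p w p' w' a b e f ha,
    path3 p w p' w' a b e f hb,
    Matrix.trace_fin_two, Matrix.mul_apply, Fin.sum_univ_two]
  simp; field_simp; ring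

lemma lead_234 : HasLead (path p w p' w' a b e f) 0 (tr3 1 2 3)
    (p' * a * b + a * f + w' * a⁻¹ * b⁻¹) := by
  refine HasLead.of_cont (fun ε => p' * a * b + (p' * w' - 1) * ε ^ 2 * a⁻¹ * e + a * f +
     w' * a⁻¹ * ((1 + e * f * ε ^ 2) * b⁻¹))
    (by fun_prop) (by simp; try ring) fun ε hε => ?_
  simp only [tr3, path1 p w p' w' a b e f ha, path2 p w p' w' a b e f hε,
    path3 p w p' w' a b e f hb,
    Matrix.trace_fin_two, Matrix.mul_apply, Fin.sum_univ_two]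
  simp; field_simp; ring
end leads

/-- The eight generators. -/
noncomputable def U : Fin 8 → Fn :=
  ![tr1 0, tr1 1, tr1 2, tr1 3, tr2 0 1, tr2 1 2, tr2 2 3, tr2 0 3]

lemma lead_U (p w p' w' a b e f : ℂ) (ha : a ≠ 0) (hb : b ≠ 0) (i : Fin 8) :
    HasLead (path p w p' w' a b e f) 0 (U i)
      (![p + w, a + a⁻¹, p' + w', b + b⁻¹, p * a + w * a⁻¹, p' * a + w' * a⁻¹,
        p' * b + f + w' * b⁻¹, p * b + e + w * b⁻¹] i) := by
  fin_cases i
  · refine HasLead.of_cont (fun ε => p + w) (by fun_prop) (by simp) fun ε hε => ?_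
    simp [U, tr1, path0 p w p' w' a b e f hε, Matrix.trace_fin_two]
  · refine HasLead.of_cont (fun ε => a + a⁻¹) (by fun_prop) (by simp) fun ε hε => ?_
    simp [U, tr1, path1 p w p' w' a b e f ha, Matrix.trace_fin_two]
  · refine HasLead.of_cont (fun ε => p' + w') (by fun_prop) (by simp) fun ε hε => ?_
    simp [U, tr1, path2 p w p' w' a b e f hε, Matrix.trace_fin_two]
  · refine HasLead.of_cont (fun ε => b + (1 + e * f * ε ^ 2) * b⁻¹) (by fun_prop) (by simp)
      fun ε hε => ?_
    simp [U, tr1, path3 p w p' w' a b e f hb, Matrix.trace_fin_two]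
  · refine HasLead.of_cont (fun ε => p * a + w * a⁻¹) (by fun_prop) (by simp) fun ε hε => ?_
    simp [U, tr2, path0 p w p' w' a b e f hε, path1 p w p' w' a b e f ha, Matrix.trace_fin_two,
      Matrix.mul_apply, Fin.sum_univ_two]
  · refine HasLead.of_cont (fun ε => p' * a + w' * a⁻¹) (by fun_prop) (by simp) fun ε hε => ?_
    simp [U, tr2, path2 p w p' w' a b e f hε, path1 p w p' w' a b e f ha, Matrix.trace_fin_two,
      Matrix.mul_apply, Fin.sum_univ_two]
    ring
  · refine HasLead.of_cont (fun ε => p' * b + f + (p' * w' - 1) * e * ε ^ 2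
      + w' * ((1 + e * f * ε ^ 2) * b⁻¹)) (by fun_prop) (by simp) fun ε hε => ?_
    simp [U, tr2, path2 p w p' w' a b e f hε, path3 p w p' w' a b e f hb, Matrix.trace_fin_two,
      Matrix.mul_apply, Fin.sum_univ_two]
    field_simp; ring
  · refine HasLead.of_cont (fun ε => p * b + e + (p * w - 1) * f * ε ^ 2
      + w * ((1 + e * f * ε ^ 2) * b⁻¹)) (by fun_prop) (by simp) fun ε hε => ?_
    simp [U, tr2, path0 p w p' w' a b e f hε, path3 p w p' w' a b e f hb, Matrix.trace_fin_two,
      Matrix.mul_apply, Fin.sum_univ_two]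
    field_simp; ring

lemma aevalU_apply (A : MvPolynomial (Fin 8) ℂ) (ρ : Fin 4 → SL2) :
    (aeval U A : Fn) ρ = eval (fun i => U i ρ) A := by
  induction A using MvPolynomial.induction_on with
  | C c => simp
  | add p q hp hq => simp [hp, hq]
  | mul_X p i hp => simp [hp]

lemma lead_coef (p w p' w' a b e f : ℂ) (ha : a ≠ 0) (hb : b ≠ 0)
    (A : MvPolynomial (Fin 8) ℂ) :
    HasLead (path p w p' w' a b e f) 0 (aeval U A : Fn)
      (eval ![p + w, a + a⁻¹, p' + w', b + b⁻¹, p * a + w * a⁻¹, p' * a + w' * a⁻¹,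
        p' * b + f + w' * b⁻¹, p * b + e + w * b⁻¹] A) := by
  have h1 : Tendsto (fun ε i => U i (path p w p' w' a b e f ε)) (𝓝[≠] 0)
      (𝓝 ![p + w, a + a⁻¹, p' + w', b + b⁻¹, p * a + w * a⁻¹, p' * a + w' * a⁻¹,
        p' * b + f + w' * b⁻¹, p * b + e + w * b⁻¹]) := by
    rw [tendsto_pi_nhds]
    intro i
    have := lead_U p w p' w' a b e f ha hb i
    simpa [HasLead] using this
  have h2 := ((MvPolynomial.continuous_eval A).tendsto _).comp h1
  simpa [HasLead, aevalU_apply, Function.comp_def] using h2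

/-- growth order at most `n` at the place `t₁₃ = ∞` -/
def Ox (n : ℕ) (g : Fn) : Prop :=
  ∀ p w p' w' a b e f : ℂ, a ≠ 0 → b ≠ 0 → ∃ L, HasLead (path p w p' w' a b e f) n g L

/-- growth order less than `n` at the place `t₁₃ = ∞` -/
def Sx (n : ℕ) (g : Fn) : Prop :=
  ∀ p w p' w' a b e f : ℂ, a ≠ 0 → b ≠ 0 → HasLead (path p w p' w' a b e f) n g 0

lemma Ox.mul {n m : ℕ} {g h : Fn} (hg : Ox n g) (hh : Ox m h) : Ox (n + m) (g * h) := by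
  intro p w p' w' a b e f ha hb
  obtain ⟨L, hL⟩ := hg p w p' w' a b e f ha hb
  obtain ⟨M, hM⟩ := hh p w p' w' a b e f ha hb
  exact ⟨_, hL.mul hM⟩

lemma Ox.pow {n : ℕ} {g : Fn} (hg : Ox n g) (k : ℕ) : Ox (k * n) (g ^ k) := by
  intro p w p' w' a b e f ha hb
  obtain ⟨L, hL⟩ := hg p w p' w' a b e f ha hb
  exact ⟨_, hL.pow k⟩

lemma Ox.small {n m : ℕ} {g : Fn} (hg : Ox n g) (h : n < m) : Sx m g := by
  intro p w p' w' a b e f ha hb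
  obtain ⟨L, hL⟩ := hg p w p' w' a b e f ha hb
  exact hL.raise h

lemma Sx.sum {ι : Type*} {n : ℕ} (s : Finset ι) (g : ι → Fn) (h : ∀ i ∈ s, Sx n (g i)) :
    Sx n (∑ i ∈ s, g i) := by
  classical
  induction s using Finset.induction_on with
  | empty => intro p w p' w' a b e f ha hb; simpa using HasLead.zero
  | insert i s hi ih =>
    intro p w p' w' a b e f ha hb
    rw [Finset.sum_insert hi]
    have h1 := h i (Finset.mem_insert_self _ _) p w p' w' a b e f ha hb
    have h2 := ih (fun j hj => h j (Finset.mem_insert_of_mem hj)) p w p' w' a b e f ha hb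
    simpa using h1.add h2

lemma Ox_x : Ox 1 (tr2 0 2) := fun p w p' w' a b e f ha hb => ⟨_, lead_x p w p' w' a b e f ha hb⟩
lemma Ox_z : Ox 0 (tr2 1 3) := fun p w p' w' a b e f ha hb => ⟨_, lead_z p w p' w' a b e f ha hb⟩
lemma Ox_123 : Ox 1 (tr3 0 1 2) :=
  fun p w p' w' a b e f ha hb => ⟨_, lead_123 p w p' w' a b e f ha hb⟩
lemma Ox_134 : Ox 1 (tr3 0 2 3) :=
  fun p w p' w' a b e f ha hb => ⟨_, lead_134 p w p' w' a b e f ha hb⟩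
lemma Ox_124 : Ox 0 (tr3 0 1 3) :=
  fun p w p' w' a b e f ha hb => ⟨_, lead_124 p w p' w' a b e f ha hb⟩
lemma Ox_234 : Ox 0 (tr3 1 2 3) :=
  fun p w p' w' a b e f ha hb => ⟨_, lead_234 p w p' w' a b e f ha hb⟩
lemma Ox_coef (A : MvPolynomial (Fin 8) ℂ) : Ox 0 (aeval U A : Fn) :=
  fun p w p' w' a b e f ha hb => ⟨_, lead_coef p w p' w' a b e f ha hb A⟩
lemma Ox_one : Ox 0 1 := fun p w p' w' a b e f _ _ => ⟨_, HasLead.one⟩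

lemma exists_root (t : ℂ) : ∃ a : ℂ, a ≠ 0 ∧ a + a⁻¹ = t := by
  obtain ⟨s, hs⟩ := IsAlgClosed.exists_pow_nat_eq (t ^ 2 - 4) (n := 2) (by norm_num)
  have h0 : (t + s) * (t - s) = 4 := by linear_combination -hs
  have h1 : t + s ≠ 0 := by
    intro h; rw [h] at h0; norm_num at h0
  refine ⟨(t + s) / 2, by simpa using h1, ?_⟩
  field_simp
  linear_combination hs

lemma core_lim (A : Fin 4 → MvPolynomial (Fin 8) ℂ) (n : ℕ) (r : Fn) (hr : Sx (n + 1) r)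
    (hrel : aeval U (A 0) * tr2 0 2 ^ (n + 1) + aeval U (A 1) * (tr2 0 2 ^ (n + 1) * tr2 1 3) +
      aeval U (A 2) * (tr2 0 2 ^ n * tr3 0 1 2) + aeval U (A 3) * (tr2 0 2 ^ n * tr3 0 2 3) + r = 0)
    (u : Fin 8 → ℂ) (a b : ℂ) (ha : a ≠ 0) (hb : b ≠ 0) (ha1 : a - a⁻¹ ≠ 0)
    (hu1 : a + a⁻¹ = u 1) (hu3 : b + b⁻¹ = u 3) :
    eval u (A 0) + eval u (A 1) * (a * b + a⁻¹ * b⁻¹) + eval u (A 2) * a +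
      eval u (A 3) * b⁻¹ = 0 := by
  set p := (u 4 - u 0 * a⁻¹) / (a - a⁻¹) with hp
  set p' := (u 5 - u 2 * a⁻¹) / (a - a⁻¹) with hp'
  set w := u 0 - p with hw
  set w' := u 2 - p' with hw'
  set f := u 6 - p' * b - w' * b⁻¹ with hf
  set e := u 7 - p * b - w * b⁻¹ with he
  have hpm : p * (a - a⁻¹) = u 4 - u 0 * a⁻¹ := by rw [hp]; exact div_mul_cancel₀ _ ha1
  have hpm' : p' * (a - a⁻¹) = u 5 - u 2 * a⁻¹ := by rw [hp']; exact div_mul_cancel₀ _ ha1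
  have hu : ![p + w, a + a⁻¹, p' + w', b + b⁻¹, p * a + w * a⁻¹, p' * a + w' * a⁻¹,
        p' * b + f + w' * b⁻¹, p * b + e + w * b⁻¹] = u := by
    funext i
    fin_cases i
    · simp [hw]
    · simpa using hu1
    · simp [hw']
    · simpa using hu3
    · simp only [hw]; simp; linear_combination hpm
    · simp only [hw']; simp; linear_combination hpm'
    · simp [hf]; ring
    · simp [he]; ring
  have hc := fun B => lead_coef p w p' w' a b e f ha hb B
  rw [hu] at hc
  have hx := lead_x p w p' w' a b e f ha hb
  have hz := lead_z p w p' w' a b e f ha hb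
  have h0 := (hc (A 0)).mul (hx.pow (n + 1))
  have h1 := (hc (A 1)).mul ((hx.pow (n + 1)).mul hz)
  have h2 := (hc (A 2)).mul ((hx.pow n).mul (lead_123 p w p' w' a b e f ha hb))
  have h3 := (hc (A 3)).mul ((hx.pow n).mul (lead_134 p w p' w' a b e f ha hb))
  have h4 := hr p w p' w' a b e f ha hb
  simp only [mul_one, add_zero, zero_add, one_pow, one_mul] at h0 h1 h2 h3
  have h5 := (((h0.add h1).add h2).add h3).add h4
  rw [hrel] at h5
  have := h5.unique HasLead.zero
  simpa using this

lemma core_x (A : Fin 4 → MvPolynomial (Fin 8) ℂ) (n : ℕ) (r : Fn) (hr : Sx (n + 1) r)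
    (hrel : aeval U (A 0) * tr2 0 2 ^ (n + 1) + aeval U (A 1) * (tr2 0 2 ^ (n + 1) * tr2 1 3) +
      aeval U (A 2) * (tr2 0 2 ^ n * tr3 0 1 2) + aeval U (A 3) * (tr2 0 2 ^ n * tr3 0 2 3)
      + r = 0) : A = 0 := by
  have key : ∀ u : Fin 8 → ℂ, u 1 ^ 2 - 4 ≠ 0 → u 3 ^ 2 - 4 ≠ 0 → ∀ i, eval u (A i) = 0 := by
    intro u h1 h3
    obtain ⟨a, ha, hua⟩ := exists_root (u 1)
    obtain ⟨b, hb, hub⟩ := exists_root (u 3)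
    have hia : a⁻¹ ≠ 0 := inv_ne_zero ha
    have hib : b⁻¹ ≠ 0 := inv_ne_zero hb
    have hab : a * a⁻¹ = 1 := mul_inv_cancel₀ ha
    have hbb : b * b⁻¹ = 1 := mul_inv_cancel₀ hb
    have ha1 : a - a⁻¹ ≠ 0 := by
      intro h; apply h1; rw [← hua]
      linear_combination (a - a⁻¹) * h + 4 * hab
    have hb1 : b - b⁻¹ ≠ 0 := by
      intro h; apply h3; rw [← hub]
      linear_combination (b - b⁻¹) * h + 4 * hbb
    have ha2 : a⁻¹ - a⁻¹⁻¹ ≠ 0 := by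
      rw [inv_inv]; intro h; apply ha1; linear_combination -h
    have E1 := core_lim A n r hr hrel u a b ha hb ha1 hua hub
    have E2 := core_lim A n r hr hrel u a⁻¹ b hia hb ha2 (by rw [inv_inv, add_comm]; exact hua) hub
    have E3 := core_lim A n r hr hrel u a b⁻¹ ha hib ha1 hua (by rw [inv_inv, add_comm]; exact hub)
    have E4 := core_lim A n r hr hrel u a⁻¹ b⁻¹ hia hib ha2 (by rw [inv_inv, add_comm]; exact hua)
      (by rw [inv_inv, add_comm]; exact hub)
    rw [inv_inv] at E2 E3 E4
    rw [inv_inv] at E4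

    have F1 : eval u (A 1) * (b - b⁻¹) + eval u (A 2) = 0 := by
      apply mul_left_cancel₀ ha1; linear_combination E1 - E2
    have F2 : eval u (A 1) * (b⁻¹ - b) + eval u (A 2) = 0 := by
      apply mul_left_cancel₀ ha1; linear_combination E3 - E4
    have G1 : eval u (A 1) = 0 := by
      apply mul_left_cancel₀ hb1; linear_combination (F1 - F2) / 2
    have G2 : eval u (A 2) = 0 := by rw [G1] at F1; simpa using F1
    have G3 : eval u (A 3) = 0 := by
      rw [G1, G2] at E1 E3
      apply mul_left_cancel₀ hb1; linear_combination E3 - E1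
    have G0 : eval u (A 0) = 0 := by
      rw [G1, G2, G3] at E1; simpa using E1
    intro i
    fin_cases i
    · exact G0
    · exact G1
    · exact G2
    · exact G3
  funext i
  have hz : A i * ((X 1 ^ 2 - C 4) * (X 3 ^ 2 - C 4)) = 0 := by
    apply MvPolynomial.funext
    intro u
    simp only [map_mul, map_sub, map_pow, eval_X, eval_C, map_zero]
    by_cases h1 : u 1 ^ 2 - 4 = 0
    · simp [h1]
    by_cases h3 : u 3 ^ 2 - 4 = 0
    · simp [h3]
    rw [key u h1 h3 i, zero_mul]
  have hne : ∀ j : Fin 8, (X j ^ 2 - C 4 : MvPolynomial (Fin 8) ℂ) ≠ 0 := by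
    intro j h
    have := congrArg (eval (fun _ => (0 : ℂ))) h
    simp at this
  rcases mul_eq_zero.mp hz with h | h
  · exact h
  · exact absurd h (mul_ne_zero (hne 1) (hne 3))

/-- cyclic rotation of the indices -/
def rot (ρ : Fin 4 → SL2) : Fin 4 → SL2 := fun i => ρ (i + 1)

def tau : Fin 8 → Fin 8 := ![1, 2, 3, 0, 5, 6, 7, 4]

lemma tau_inj : Function.Injective tau := by decide

lemma rot_U (i : Fin 8) : U i ∘ rot = U (tau i) := by
  funext ρ
  fin_cases i
  · rfl
  · rfl
  · rfl
  · rfl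
  · rfl
  · rfl
  · exact Matrix.trace_mul_comm (ρ 3 : M2) (ρ 0 : M2)
  · exact Matrix.trace_mul_comm (ρ 1 : M2) (ρ 0 : M2)

lemma rot_coef (A : MvPolynomial (Fin 8) ℂ) :
    (aeval U A : Fn) ∘ rot = aeval U (rename tau A) := by
  funext ρ
  rw [aevalU_apply, eval_rename, Function.comp_apply, aevalU_apply]
  congr 2
  funext i
  exact congrFun (rot_U i) ρ

lemma rot_x : tr2 0 2 ∘ rot = tr2 1 3 := rfl
lemma rot_z : tr2 1 3 ∘ rot = tr2 0 2 := by
  funext ρ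
  exact Matrix.trace_mul_comm (ρ 2 : M2) (ρ 0 : M2)
lemma rot_123 : tr3 0 1 2 ∘ rot = tr3 1 2 3 := rfl
lemma cyc3 (A B C : M2) : Matrix.trace (A * B * C) = Matrix.trace (C * A * B) := by
  rw [Matrix.trace_mul_comm, Matrix.mul_assoc]
lemma rot_134 : tr3 0 2 3 ∘ rot = tr3 0 1 3 := by
  funext ρ
  exact cyc3 (ρ 1 : M2) (ρ 3) (ρ 0)
lemma rot_124 : tr3 0 1 3 ∘ rot = tr3 0 1 2 := by
  funext ρ
  exact cyc3 (ρ 1 : M2) (ρ 2) (ρ 0)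
lemma rot_234 : tr3 1 2 3 ∘ rot = tr3 0 2 3 := by
  funext ρ
  exact cyc3 (ρ 2 : M2) (ρ 3) (ρ 0)

lemma comp_mul (f g : Fn) : (f * g) ∘ rot = f ∘ rot * g ∘ rot := rfl
lemma comp_add (f g : Fn) : (f + g) ∘ rot = f ∘ rot + g ∘ rot := rfl
lemma comp_pow (f : Fn) (n : ℕ) : (f ^ n) ∘ rot = (f ∘ rot) ^ n := rfl
lemma comp_one : (1 : Fn) ∘ rot = 1 := rfl
lemma comp_zero : (0 : Fn) ∘ rot = 0 := rfl

lemma core_z (A : Fin 4 → MvPolynomial (Fin 8) ℂ) (n : ℕ) (r : Fn) (hr : Sx (n + 1) (r ∘ rot))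
    (hrel : aeval U (A 0) * tr2 1 3 ^ (n + 1) + aeval U (A 1) * (tr2 1 3 ^ (n + 1) * tr2 0 2) +
      aeval U (A 2) * (tr2 1 3 ^ n * tr3 0 1 3) + aeval U (A 3) * (tr2 1 3 ^ n * tr3 1 2 3)
      + r = 0) : A = 0 := by
  have h := congrArg (fun g : Fn => g ∘ rot) hrel
  simp only [comp_mul, comp_add, comp_pow, comp_zero, rot_x, rot_z, rot_124, rot_234,
    rot_coef] at h
  have h2 := core_x (fun i => rename tau (A i)) n _ hr h
  funext i
  have h3 := congrFun h2 i
  exact (rename_injective tau tau_inj) (by simpa using h3)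

noncomputable def wv : Fin 8 → Fn :=
  ![1, tr2 1 3, tr3 0 1 2, tr3 0 2 3, tr2 1 3 ^ 2, tr2 1 3 ^ 2 * tr2 0 2, tr3 0 1 3, tr3 1 2 3]

noncomputable def bv : Fin 8 → Fn :=
  ![tr2 0 2, tr2 0 2, tr2 0 2, tr2 0 2, tr2 1 3, tr2 1 3, tr2 1 3, tr2 1 3]

noncomputable def al (i : Fin 8 × ℕ) : Fn := bv i.1 ^ i.2 * wv i.1

def ordx (i : Fin 8 × ℕ) : ℕ := ![i.2, i.2, i.2 + 1, i.2 + 1, 0, 1, 0, 0] i.1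
def ordz (i : Fin 8 × ℕ) : ℕ := ![0, 1, 0, 0, i.2 + 2, i.2 + 2, i.2 + 1, i.2 + 1] i.1

lemma al_Ox (i : Fin 8 × ℕ) : Ox (ordx i) (al i) := by
  obtain ⟨j, k⟩ := i
  have e1 : k * 1 + 0 = k := by omega
  have e2 : k * 1 + 1 = k + 1 := by omega
  have e3 : k * 0 + 0 = 0 := by omega
  have e4 : k * 0 + (2 * 0 + 1) = 1 := by omega
  have e5 : k * 0 + 2 * 0 = 0 := by omega
  fin_cases j
  · have := (Ox_x.pow k).mul Ox_one; rw [e1] at this; exact this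
  · have := (Ox_x.pow k).mul Ox_z; rw [e1] at this; exact this
  · have := (Ox_x.pow k).mul Ox_123; rw [e2] at this; exact this
  · have := (Ox_x.pow k).mul Ox_134; rw [e2] at this; exact this
  · have := (Ox_z.pow k).mul (Ox_z.pow 2); rw [e5] at this; exact this
  · have := (Ox_z.pow k).mul ((Ox_z.pow 2).mul Ox_x); rw [e4] at this; exact this
  · have := (Ox_z.pow k).mul Ox_124; rw [e3] at this; exact this
  · have := (Ox_z.pow k).mul Ox_234; rw [e3] at this; exact this

lemma al_Oz (i : Fin 8 × ℕ) : Ox (ordz i) (al i ∘ rot) := by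
  obtain ⟨j, k⟩ := i
  have e0 : k * 0 + 1 = 1 := by omega
  have e2 : k * 1 + 1 = k + 1 := by omega
  have e3 : k * 0 + 0 = 0 := by omega
  have e4 : k * 1 + (2 * 1 + 0) = k + 2 := by omega
  have e5 : k * 1 + 2 * 1 = k + 2 := by omega
  unfold al
  rw [comp_mul, comp_pow]
  fin_cases j
  · have := (Ox_z.pow k).mul Ox_one; rw [e3] at this; exact this
  · have := (Ox_z.pow k).mul Ox_x; rw [e0, ← rot_z] at this; exact this
  · have := (Ox_z.pow k).mul Ox_234; rw [e3] at this; exact this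
  · have := (Ox_z.pow k).mul Ox_124; rw [e3, ← rot_134] at this; exact this
  · have := (Ox_x.pow k).mul (Ox_x.pow 2); rw [e5, ← rot_z] at this; exact this
  · have := (Ox_x.pow k).mul ((Ox_x.pow 2).mul Ox_z); rw [e4, ← rot_z] at this; exact this
  · have := (Ox_x.pow k).mul Ox_123; rw [e2, ← rot_124, ← rot_z] at this; exact this
  · have := (Ox_x.pow k).mul Ox_134; rw [e2, ← rot_234, ← rot_z] at this; exact this

abbrev R8 : Type := MvPolynomial (Fin 8) ℂ

lemma Sx_zero (n : ℕ) : Sx n 0 := fun _ _ _ _ _ _ _ _ _ _ => HasLead.zero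

section steps
variable (l : Fin 8 × ℕ →₀ R8) (hl : ∀ s, l.support ⊆ s → ∑ i ∈ s, aeval U (l i) * al i = 0)
include hl

lemma split (T : Finset (Fin 8 × ℕ)) :
    ∑ i ∈ T, aeval U (l i) * al i + ∑ i ∈ l.support \ T, aeval U (l i) * al i = 0 := by
  classical
  rw [add_comm]
  have := hl (l.support ∪ T) Finset.subset_union_left
  rw [← this, ← Finset.sum_sdiff (Finset.subset_union_right : T ⊆ l.support ∪ T),
    Finset.union_sdiff_right]

omit hl in
lemma rem_x (n : ℕ) (T : Finset (Fin 8 × ℕ)) (h : ∀ i, n ≤ ordx i → i ∉ T → l i = 0) :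
    Sx n (∑ i ∈ l.support \ T, aeval U (l i) * al i) := by
  refine Sx.sum _ _ fun i hi => ?_
  rw [Finset.mem_sdiff, Finsupp.mem_support_iff] at hi
  have : ordx i < n := by
    by_contra hc
    exact hi.1 (h i (by omega) hi.2)
  exact ((Ox_coef _).mul (al_Ox i)).small (by omega)

omit hl in
lemma rem_z (n : ℕ) (T : Finset (Fin 8 × ℕ)) (h : ∀ i, n ≤ ordz i → i ∉ T → l i = 0) :
    Sx n ((∑ i ∈ l.support \ T, aeval U (l i) * al i) ∘ rot) := by
  have e : (∑ i ∈ l.support \ T, aeval U (l i) * al i) ∘ rot =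
      ∑ i ∈ l.support \ T, (aeval U (l i) * al i) ∘ rot := by
    funext ρ; simp [Finset.sum_apply]
  rw [e]
  refine Sx.sum _ _ fun i hi => ?_
  rw [Finset.mem_sdiff, Finsupp.mem_support_iff] at hi
  have : ordz i < n := by
    by_contra hc
    exact hi.1 (h i (by omega) hi.2)
  rw [comp_mul, rot_coef]
  exact ((Ox_coef _).mul (al_Oz i)).small (by omega)

lemma step_x (n : ℕ)
    (h : ∀ i, n + 1 ≤ ordx i → i ∉ ({(0, n + 1), (1, n + 1), (2, n), (3, n)} : Finset (Fin 8 × ℕ)) →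
      l i = 0) : l (0, n + 1) = 0 ∧ l (1, n + 1) = 0 ∧ l (2, n) = 0 ∧ l (3, n) = 0 := by
  have h1 := split l hl {(0, n + 1), (1, n + 1), (2, n), (3, n)}
  have h2 := rem_x l _ _ h
  rw [Finset.sum_insert (by simp), Finset.sum_insert (by simp), Finset.sum_insert (by simp),
    Finset.sum_singleton] at h1
  have h3 := core_x ![l (0, n + 1), l (1, n + 1), l (2, n), l (3, n)] n _ h2 (by
    rw [← h1]
    simp [al, bv, wv]
    ring)
  exact ⟨congrFun h3 0, congrFun h3 1, congrFun h3 2, congrFun h3 3⟩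

lemma step_z (n : ℕ)
    (h : ∀ i, n + 2 ≤ ordz i → i ∉ ({(4, n), (5, n), (6, n + 1), (7, n + 1)} : Finset (Fin 8 × ℕ)) →
      l i = 0) : l (4, n) = 0 ∧ l (5, n) = 0 ∧ l (6, n + 1) = 0 ∧ l (7, n + 1) = 0 := by
  have h1 := split l hl {(4, n), (5, n), (6, n + 1), (7, n + 1)}
  have h2 := rem_z l _ _ h
  rw [Finset.sum_insert (by simp), Finset.sum_insert (by simp), Finset.sum_insert (by simp),
    Finset.sum_singleton] at h1
  have h3 := core_z ![l (4, n), l (5, n), l (6, n + 1), l (7, n + 1)] (n + 1) _ h2 (by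
    rw [← h1]
    simp [al, bv, wv]
    ring)
  exact ⟨congrFun h3 0, congrFun h3 1, congrFun h3 2, congrFun h3 3⟩

lemma step_z0
    (h : ∀ i, 1 ≤ ordz i → i ∉ ({(1, 0), (6, 0), (7, 0)} : Finset (Fin 8 × ℕ)) →
      l i = 0) : l (1, 0) = 0 ∧ l (6, 0) = 0 ∧ l (7, 0) = 0 := by
  have h1 := split l hl {(1, 0), (6, 0), (7, 0)}
  have h2 := rem_z l _ _ h
  rw [Finset.sum_insert (by simp), Finset.sum_insert (by simp),
    Finset.sum_singleton] at h1
  have h3 := core_z ![l (1, 0), 0, l (6, 0), l (7, 0)] 0 _ h2 (by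
    rw [← h1]
    simp [al, bv, wv]
    ring)
  exact ⟨congrFun h3 0, congrFun h3 2, congrFun h3 3⟩

lemma all_zero : l = 0 := by
  obtain ⟨K, hK⟩ : ∃ K, ∀ j k, K ≤ k → l (j, k) = 0 := by
    refine ⟨l.support.sup Prod.snd + 1, fun j k hk => ?_⟩
    by_contra hc
    have : k ≤ l.support.sup Prod.snd :=
      Finset.le_sup (f := Prod.snd) (Finsupp.mem_support_iff.mpr hc)
    omega
  have hx : ∀ d n, 1 ≤ n → K ≤ n + d →
      l (0, n + 1) = 0 ∧ l (1, n + 1) = 0 ∧ l (2, n) = 0 ∧ l (3, n) = 0 := by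
    intro d
    induction d with
    | zero => intro n _ h; exact ⟨hK _ _ (by omega), hK _ _ (by omega), hK _ _ (by omega),
        hK _ _ (by omega)⟩
    | succ d ih =>
      intro n hn h
      apply step_x l hl
      rintro ⟨j, k⟩ hi hT
      have hk := ih (k - 1)
      have hk' := ih k
      fin_cases j <;> simp [ordx] at hi hT
      · have := (hk (by omega) (by omega)).1; rwa [Nat.sub_add_cancel (by omega)] at this
      · have := (hk (by omega) (by omega)).2.1; rwa [Nat.sub_add_cancel (by omega)] at this
      · exact (hk' (by omega) (by omega)).2.2.1
      · exact (hk' (by omega) (by omega)).2.2.2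
      · omega
  have hz : ∀ d n, K ≤ n + d →
      l (4, n) = 0 ∧ l (5, n) = 0 ∧ l (6, n + 1) = 0 ∧ l (7, n + 1) = 0 := by
    intro d
    induction d with
    | zero => intro n h; exact ⟨hK _ _ (by omega), hK _ _ (by omega), hK _ _ (by omega),
        hK _ _ (by omega)⟩
    | succ d ih =>
      intro n h
      apply step_z l hl
      rintro ⟨j, k⟩ hi hT
      have hk := ih (k - 1)
      have hk' := ih k
      fin_cases j <;> simp [ordz] at hi hT
      · exact (hk' (by omega)).1
      · exact (hk' (by omega)).2.1
      · have := (hk (by omega)).2.2.1; rwa [Nat.sub_add_cancel (by omega)] at this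
      · have := (hk (by omega)).2.2.2; rwa [Nat.sub_add_cancel (by omega)] at this
  have hx' := fun n hn => hx K n hn (by omega)
  have hz' := fun n => hz K n (by omega)
  have hx0 : l (0, 1) = 0 ∧ l (1, 1) = 0 ∧ l (2, 0) = 0 ∧ l (3, 0) = 0 := by
    apply step_x l hl
    rintro ⟨j, k⟩ hi hT
    have hk := hx' (k - 1)
    have hk' := hx' k
    fin_cases j <;> simp [ordx] at hi hT
    · have := (hk (by omega)).1; rwa [Nat.sub_add_cancel (by omega)] at this
    · have := (hk (by omega)).2.1; rwa [Nat.sub_add_cancel (by omega)] at this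
    · exact (hk' (by omega)).2.2.1
    · exact (hk' (by omega)).2.2.2
    · exact (hz' k).2.1
  have hz0 : l (1, 0) = 0 ∧ l (6, 0) = 0 ∧ l (7, 0) = 0 := by
    apply step_z0 l hl
    rintro ⟨j, k⟩ hi hT
    have hk := hx' (k - 1)
    have hzk := hz' (k - 1)
    fin_cases j <;> simp [ordz] at hi hT
    · by_cases h1 : k = 1
      · subst h1; exact hx0.2.1
      · have := (hk (by omega)).2.1; rwa [Nat.sub_add_cancel (by omega)] at this
    · exact (hz' k).1
    · exact (hz' k).2.1
    · have := hzk.2.2.1; rwa [Nat.sub_add_cancel (by omega)] at this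
    · have := hzk.2.2.2; rwa [Nat.sub_add_cancel (by omega)] at this
  have hne : ∀ i, i ≠ (0, 0) → l i = 0 := by
    rintro ⟨j, k⟩ hi
    rcases k with _ | _ | k
    · fin_cases j
      · exact absurd rfl hi
      · exact hz0.1
      · exact hx0.2.2.1
      · exact hx0.2.2.2
      · exact (hz' 0).1
      · exact (hz' 0).2.1
      · exact hz0.2.1
      · exact hz0.2.2
    · fin_cases j
      · exact hx0.1
      · exact hx0.2.1
      · exact (hx' 1 le_rfl).2.2.1
      · exact (hx' 1 le_rfl).2.2.2
      · exact (hz' 1).1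
      · exact (hz' 1).2.1
      · exact (hz' 0).2.2.1
      · exact (hz' 0).2.2.2
    · fin_cases j
      · exact (hx' (k + 1) (by omega)).1
      · exact (hx' (k + 1) (by omega)).2.1
      · exact (hx' (k + 2) (by omega)).2.2.1
      · exact (hx' (k + 2) (by omega)).2.2.2
      · exact (hz' (k + 2)).1
      · exact (hz' (k + 2)).2.1
      · exact (hz' (k + 1)).2.2.1
      · exact (hz' (k + 1)).2.2.2
  have h00 := hl {(0, 0)} (by
    intro i hi
    rw [Finset.mem_singleton]
    by_contra hc
    exact (Finsupp.mem_support_iff.mp hi) (hne i hc))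
  have h01 : (aeval U (l (0, 0)) : Fn) = 0 := by
    simpa [al, bv, wv] using h00
  have h02 := core_x ![l (0, 0), 0, 0, 0] 0 0 (Sx_zero _) (by
    simp [h01])
  ext1 i
  by_cases hi : i = (0, 0)
  · rw [hi]; exact congrFun h02 0
  · exact hne i hi
end steps

/-- The `R8`-module structure on functions given by the eight generators. -/
noncomputable abbrev algU : Algebra R8 Fn := (aeval U : R8 →ₐ[ℂ] Fn).toRingHom.toAlgebra

/-- The reindexed family. -/
noncomputable def Bal (q : (Fin 8 →₀ ℕ) × (Fin 8 × ℕ)) : Fn :=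
  (aeval U (monomial q.1 (1 : ℂ)) : Fn) * al q.2

lemma Bal_li : LinearIndependent ℂ Bal := by
  letI : Algebra R8 Fn := algU
  have hsm : ∀ (A : R8) (f : Fn), A • f = aeval U A * f := fun A f => rfl
  haveI : IsScalarTower ℂ R8 Fn := by
    constructor
    intro c A f
    rw [hsm, hsm, map_smul, smul_mul_assoc]
  have h1 : LinearIndependent R8 al := by
    rw [linearIndependent_iff]
    intro l hl
    apply all_zero
    intro s hs
    rw [← hl, Finsupp.linearCombination_apply, Finsupp.sum_of_support_subset _ hs]
    · rfl
    · intro i _; exact zero_smul _ _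
  have h2 := linearIndependent_smul (MvPolynomial.basisMonomials (Fin 8) ℂ).linearIndependent h1
  have e : Bal = fun q => (MvPolynomial.basisMonomials (Fin 8) ℂ) q.1 • al q.2 := by
    funext q
    rw [coe_basisMonomials, hsm]
    rfl
  rw [e]
  exact h2

lemma Aset_al (a : Aset) : ∃ i, al i = (a : Fn) := by
  obtain ⟨a, ha⟩ := a
  rcases ha with (ha | ⟨k, hk, ha⟩) | ⟨k, ha⟩
  · rcases ha with rfl | rfl | rfl | rfl
    · exact ⟨(0, 0), by simp [al, bv, wv]⟩
    · exact ⟨(0, 1), by simp [al, bv, wv]⟩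
    · exact ⟨(1, 0), by simp [al, bv, wv]⟩
    · exact ⟨(1, 1), by simp [al, bv, wv]⟩
  · obtain ⟨k, rfl⟩ := Nat.exists_eq_add_of_le hk
    rcases ha with rfl | rfl | rfl | rfl
    · exact ⟨(0, 2 + k), by simp [al, bv, wv]⟩
    · exact ⟨(1, 2 + k), by simp [al, bv, wv]⟩
    · exact ⟨(4, k), by simp [al, bv, wv]; ring⟩
    · exact ⟨(5, k), by simp [al, bv, wv]; ring⟩
  · rcases ha with rfl | rfl | rfl | rfl
    · exact ⟨(2, k), by simp [al, bv, wv]⟩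
    · exact ⟨(3, k), by simp [al, bv, wv]⟩
    · exact ⟨(6, k), by simp [al, bv, wv]⟩
    · exact ⟨(7, k), by simp [al, bv, wv]⟩

lemma Bfam_li : LinearIndependent ℂ Bfam := by
  choose s hs using Aset_al
  have hinj : Function.Injective
      (fun q : (Fin 8 → ℕ) × Aset => (Finsupp.equivFunOnFinite.symm q.1, s q.2)) := by
    rintro ⟨m, a⟩ ⟨m', a'⟩ h
    simp only [Prod.mk.injEq] at h
    have h1 : m = m' := Finsupp.equivFunOnFinite.symm.injective h.1
    have h2 : a = a' := by
      apply Subtype.ext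
      rw [← hs a, ← hs a', h.2]
    rw [h1, h2]
  have := Bal_li.comp _ hinj
  convert this using 1
  funext q
  simp only [Function.comp_apply, Bal, hs, Bfam]
  congr 1
  rw [aeval_monomial, map_one, one_mul, Finsupp.prod_fintype _ _ (by simp)]
  simp [Fin.prod_univ_eight, U]

/-! ### Trace identities -/

noncomputable def qf (i j : Fin 4) : Fn := 2 * tr2 i j - tr1 i * tr1 j
noncomputable def ef (i j k : Fin 4) : Fn :=
  tr1 i * tr2 j k + tr1 j * tr2 i k + tr1 k * tr2 i j - tr1 i * tr1 j * tr1 k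
noncomputable def df (i j k : Fin 4) : Fn := 2 * tr3 i j k - ef i j k

def dl (i : Fin 4) : Fn := fun ρ => (ρ i : M2) 0 0 - (ρ i : M2) 1 1
def bb (i : Fin 4) : Fn := fun ρ => (ρ i : M2) 0 1
def cc (i : Fin 4) : Fn := fun ρ => (ρ i : M2) 1 0

lemma qf_eq (i j : Fin 4) : qf i j = dl i * dl j + 2 * (bb i * cc j + cc i * bb j) := by
  funext ρ
  simp only [qf, dl, bb, cc, tr2, tr1, Pi.mul_apply, Pi.sub_apply, Pi.add_apply, Pi.ofNat_apply,
    Matrix.trace_fin_two, Matrix.mul_apply, Fin.sum_univ_two]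
  ring

lemma df_eq (i j k : Fin 4) : df i j k = dl i * (bb j * cc k - cc j * bb k)
    - bb i * (dl j * cc k - cc j * dl k) + cc i * (dl j * bb k - bb j * dl k) := by
  funext ρ
  simp only [df, ef, dl, bb, cc, tr3, tr2, tr1, Pi.mul_apply, Pi.sub_apply, Pi.add_apply,
    Pi.ofNat_apply, Matrix.trace_fin_two, Matrix.mul_apply, Fin.sum_univ_two]
  ring

lemma qf_symm (i j : Fin 4) : qf i j = qf j i := by
  rw [qf_eq, qf_eq]; ring

lemma tr2_symm (i j : Fin 4) : tr2 i j = tr2 j i := by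
  funext ρ; exact Matrix.trace_mul_comm _ _

lemma qf_self (i : Fin 4) : qf i i = tr1 i ^ 2 - 4 := by
  funext ρ
  have h := (ρ i).det_coe
  rw [Matrix.det_fin_two] at h
  simp only [qf, tr2, tr1, Pi.mul_apply, Pi.sub_apply, Pi.add_apply, Pi.ofNat_apply, Pi.pow_apply,
    Matrix.trace_fin_two, Matrix.mul_apply, Fin.sum_univ_two]
  linear_combination (-4) * h

lemma df_mul (i j k l m n : Fin 4) : 4 * (df i j k * df l m n) +
    (qf i l * (qf j m * qf k n - qf j n * qf k m) - qf i m * (qf j l * qf k n - qf j n * qf k l)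
      + qf i n * (qf j l * qf k m - qf j m * qf k l)) = 0 := by
  simp only [df_eq, qf_eq]
  ring

lemma qf_df (s i j k l : Fin 4) : qf s i * df j k l - qf s j * df i k l + qf s k * df i j l
    - qf s l * df i j k = 0 := by
  simp only [df_eq, qf_eq]
  ring

lemma gram : qf 0 2 ^ 2 * qf 1 3 ^ 2 + (-(qf 1 1 * qf 3 3)) * qf 0 2 ^ 2
    + (-(qf 0 0 * qf 2 2)) * qf 1 3 ^ 2
    + (-2 * (qf 0 3 * qf 1 2) - 2 * (qf 0 1 * qf 2 3)) * (qf 0 2 * qf 1 3)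
    + (2 * (qf 1 2 * qf 0 1 * qf 3 3 + qf 2 3 * qf 0 3 * qf 1 1)) * qf 0 2
    + (2 * (qf 0 1 * qf 0 3 * qf 2 2 + qf 1 2 * qf 2 3 * qf 0 0)) * qf 1 3
    + (qf 0 0 * qf 1 1 * qf 2 2 * qf 3 3 - qf 0 1 ^ 2 * qf 2 2 * qf 3 3
      - qf 1 2 ^ 2 * qf 0 0 * qf 3 3 - qf 2 3 ^ 2 * qf 0 0 * qf 1 1 - qf 0 3 ^ 2 * qf 1 1 * qf 2 2
      + qf 0 1 ^ 2 * qf 2 3 ^ 2 + qf 0 3 ^ 2 * qf 1 2 ^ 2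
      - 2 * (qf 0 1 * qf 1 2 * qf 2 3 * qf 0 3)) = 0 := by
  have h := qf_df 0 0 1 2 3
  have h0 := df_mul 1 2 3 1 2 3
  have h1 := df_mul 0 2 3 1 2 3
  have h2 := df_mul 0 1 3 1 2 3
  have h3 := df_mul 0 1 2 1 2 3
  rw [qf_symm 2 1, qf_symm 3 1, qf_symm 3 2] at h0
  rw [qf_symm 2 1, qf_symm 3 1, qf_symm 3 2] at h1
  rw [qf_symm 3 1, qf_symm 3 2] at h2
  rw [qf_symm 2 1] at h3
  linear_combination (-4 * df 1 2 3) * h + qf 0 0 * h0 - qf 0 1 * h1 + qf 0 2 * h2 - qf 0 3 * h3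

lemma tr4_eq : 2 * tr4 = tr1 0 * tr3 1 2 3 + tr1 1 * tr3 0 2 3 + tr1 2 * tr3 0 1 3
    + tr1 3 * tr3 0 1 2 + (tr2 0 1 * tr2 2 3 - tr2 0 2 * tr2 1 3 + tr2 0 3 * tr2 1 2
    - tr1 0 * tr1 1 * tr2 2 3 - tr1 0 * tr1 3 * tr2 1 2 - tr1 1 * tr1 2 * tr2 0 3
    - tr1 2 * tr1 3 * tr2 0 1 + tr1 0 * tr1 1 * tr1 2 * tr1 3) := by
  funext ρ
  simp only [tr4, tr3, tr2, tr1, Pi.mul_apply, Pi.sub_apply, Pi.add_apply,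
    Pi.ofNat_apply, Matrix.trace_fin_two, Matrix.mul_apply, Fin.sum_univ_two]
  ring

/-! ### Spanning -/

lemma adjoin_mul_mem (S : Set Fn) (N : Submodule ℂ Fn) (h : ∀ s ∈ S, ∀ n ∈ N, s * n ∈ N) :
    ∀ f ∈ Algebra.adjoin ℂ S, ∀ n ∈ N, f * n ∈ N := by
  intro f hf
  induction hf using Algebra.adjoin_induction with
  | mem s hs => exact h s hs
  | algebraMap c =>
    intro n hn
    rw [← Algebra.smul_def]
    exact N.smul_mem c hn
  | add f g _ _ hf hg =>
    intro n hn
    rw [add_mul]; exact N.add_mem (hf n hn) (hg n hn)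
  | mul f g _ _ hf hg =>
    intro n hn
    rw [mul_assoc]; exact hf _ (hg n hn)

lemma of_num_mul (N : Submodule ℂ Fn) (c : ℕ) [NeZero c] (f : Fn) (h : (c : Fn) * f ∈ N) :
    f ∈ N := by
  have h1 := N.smul_mem ((c : ℂ)⁻¹) h
  have h2 : ((c : ℂ)⁻¹) • ((c : Fn) * f) = f := by
    funext ρ
    simp [NeZero.ne]
  rwa [h2] at h1

noncomputable def NB : Submodule ℂ Fn := Submodule.span ℂ (Set.range Bfam)

lemma NB_gen : ∀ s ∈ ({tr1 0, tr1 1, tr1 2, tr1 3, tr2 0 1, tr2 1 2, tr2 2 3, tr2 0 3} : Set Fn),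
    ∀ n ∈ NB, s * n ∈ NB := by
  have key : ∀ (s : Fn) (j : Fin 8), (∀ m a, s * Bfam (m, a) =
      Bfam (Function.update m j (m j + 1), a)) → ∀ n ∈ NB, s * n ∈ NB := by
    intro s j hs n hn
    induction hn using Submodule.span_induction with
    | mem x hx =>
      obtain ⟨⟨m, a⟩, rfl⟩ := hx
      rw [hs]
      exact Submodule.subset_span ⟨_, rfl⟩
    | zero => rw [mul_zero]; exact NB.zero_mem
    | add x y _ _ hx hy => rw [mul_add]; exact NB.add_mem hx hy
    | smul c x _ hx => rw [mul_smul_comm]; exact NB.smul_mem c hx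
  rintro s (rfl | rfl | rfl | rfl | rfl | rfl | rfl | rfl)
  · exact key _ 0 fun m a => by simp [Bfam, Function.update]; ring
  · exact key _ 1 fun m a => by simp [Bfam, Function.update]; ring
  · exact key _ 2 fun m a => by simp [Bfam, Function.update]; ring
  · exact key _ 3 fun m a => by simp [Bfam, Function.update]; ring
  · exact key _ 4 fun m a => by simp [Bfam, Function.update]; ring
  · exact key _ 5 fun m a => by simp [Bfam, Function.update]; ring
  · exact key _ 6 fun m a => by simp [Bfam, Function.update]; ring
  · exact key _ 7 fun m a => by simp [Bfam, Function.update]; ring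

lemma NB_Q (q : Fn) (hq : q ∈ Qalg) (n : Fn) (hn : n ∈ NB) : q * n ∈ NB :=
  adjoin_mul_mem _ NB NB_gen q hq n hn

lemma NB_A (a : Fn) (ha : a ∈ Aset) : a ∈ NB :=
  Submodule.subset_span ⟨(0, ⟨a, ha⟩), by simp [Bfam]⟩

lemma al_mem (i : Fin 8 × ℕ) : al i ∈ NB := by
  apply NB_A
  obtain ⟨j, k⟩ := i
  fin_cases j
  · rcases k with _ | _ | k
    · left; left; left; simp [al, bv, wv]
    · left; left; right; left; simp [al, bv, wv]
    · left; right; exact ⟨k + 2, by omega, Or.inl (by simp [al, bv, wv])⟩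
  · rcases k with _ | _ | k
    · left; left; right; right; left; simp [al, bv, wv]
    · left; left; right; right; right; simp [al, bv, wv]
    · left; right; exact ⟨k + 2, by omega, Or.inr (Or.inl (by simp [al, bv, wv]))⟩
  · right; exact ⟨k, Or.inl (by simp [al, bv, wv])⟩
  · right; exact ⟨k, Or.inr (Or.inl (by simp [al, bv, wv]))⟩
  · left; right; exact ⟨k + 2, by omega, Or.inr (Or.inr (Or.inl (by simp [al, bv, wv]; ring)))⟩
  · left; right; exact ⟨k + 2, by omega, Or.inr (Or.inr (Or.inr (by simp [al, bv, wv]; ring)))⟩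
  · right; exact ⟨k, Or.inr (Or.inr (Or.inl (by simp [al, bv, wv])))⟩
  · right; exact ⟨k, Or.inr (Or.inr (Or.inr (by simp [al, bv, wv])))⟩

lemma Q1 (i : Fin 4) : tr1 i ∈ Qalg := by
  apply Algebra.subset_adjoin
  fin_cases i <;> simp
lemma Q01 : tr2 0 1 ∈ Qalg := Algebra.subset_adjoin (by simp)
lemma Q12 : tr2 1 2 ∈ Qalg := Algebra.subset_adjoin (by simp)
lemma Q23 : tr2 2 3 ∈ Qalg := Algebra.subset_adjoin (by simp)
lemma Q03 : tr2 0 3 ∈ Qalg := Algebra.subset_adjoin (by simp)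
lemma Qq (i j : Fin 4) (h : tr2 i j ∈ Qalg) : qf i j ∈ Qalg :=
  sub_mem (mul_mem (ofNat_mem Qalg 2) h) (mul_mem (Q1 i) (Q1 j))
lemma Qs (i : Fin 4) : qf i i ∈ Qalg := by
  rw [qf_self]; exact sub_mem (pow_mem (Q1 i) 2) (ofNat_mem Qalg 4)
lemma Qq01 : qf 0 1 ∈ Qalg := Qq _ _ Q01
lemma Qq12 : qf 1 2 ∈ Qalg := Qq _ _ Q12
lemma Qq23 : qf 2 3 ∈ Qalg := Qq _ _ Q23
lemma Qq03 : qf 0 3 ∈ Qalg := Qq _ _ Q03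
lemma Q2 : (2 : Fn) ∈ Qalg := ofNat_mem Qalg 2
lemma Q4 : (4 : Fn) ∈ Qalg := ofNat_mem Qalg 4
lemma Q16 : (16 : Fn) ∈ Qalg := ofNat_mem Qalg 16

set_option maxHeartbeats 1000000 in
/-- the relation for `t₁₃² t₂₄²` -/
lemma rel22 : ∃ c21 c12 c20 c02 c11 c10 c01 c00 : Fn, (c21 ∈ Qalg ∧ c12 ∈ Qalg ∧ c20 ∈ Qalg ∧
    c02 ∈ Qalg ∧ c11 ∈ Qalg ∧ c10 ∈ Qalg ∧ c01 ∈ Qalg ∧ c00 ∈ Qalg) ∧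
    16 * (tr2 0 2 ^ 2 * tr2 1 3 ^ 2) = c21 * (tr2 0 2 ^ 2 * tr2 1 3) + c12 * (tr2 0 2 * tr2 1 3 ^ 2)
     + c20 * tr2 0 2 ^ 2 + c02 * tr2 1 3 ^ 2 + c11 * (tr2 0 2 * tr2 1 3) + c10 * tr2 0 2
     + c01 * tr2 1 3 + c00 := by
  have h := gram
  have ha : -(qf 1 1 * qf 3 3) ∈ Qalg := by
    (repeat' (first
      | with_reducible assumption | with_reducible exact Qs _ | with_reducible exact Qq01 | with_reducible exact Qq12 | with_reducible exact Qq23 | with_reducible exact Qq03 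
      | with_reducible exact Q2 | with_reducible exact Q4 | with_reducible exact Q16 | with_reducible apply add_mem 
      | with_reducible apply sub_mem | with_reducible apply mul_mem | with_reducible apply neg_mem | with_reducible apply pow_mem))
  have hb : -(qf 0 0 * qf 2 2) ∈ Qalg := by
    (repeat' (first
      | with_reducible assumption | with_reducible exact Qs _ | with_reducible exact Qq01 | with_reducible exact Qq12 | with_reducible exact Qq23 | with_reducible exact Qq03 
      | with_reducible exact Q2 | with_reducible exact Q4 | with_reducible exact Q16 | with_reducible apply add_mem 
      | with_reducible apply sub_mem | with_reducible apply mul_mem | with_reducible apply neg_mem | with_reducible apply pow_mem))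
  have hg : (-2 * (qf 0 3 * qf 1 2) - 2 * (qf 0 1 * qf 2 3)) ∈ Qalg := by
    (repeat' (first
      | with_reducible assumption | with_reducible exact Qs _ | with_reducible exact Qq01 | with_reducible exact Qq12 | with_reducible exact Qq23 | with_reducible exact Qq03 
      | with_reducible exact Q2 | with_reducible exact Q4 | with_reducible exact Q16 | with_reducible apply add_mem 
      | with_reducible apply sub_mem | with_reducible apply mul_mem | with_reducible apply neg_mem | with_reducible apply pow_mem))
  have hd : (2 * (qf 1 2 * qf 0 1 * qf 3 3 + qf 2 3 * qf 0 3 * qf 1 1)) ∈ Qalg := by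
    (repeat' (first
      | with_reducible assumption | with_reducible exact Qs _ | with_reducible exact Qq01 | with_reducible exact Qq12 | with_reducible exact Qq23 | with_reducible exact Qq03 
      | with_reducible exact Q2 | with_reducible exact Q4 | with_reducible exact Q16 | with_reducible apply add_mem 
      | with_reducible apply sub_mem | with_reducible apply mul_mem | with_reducible apply neg_mem | with_reducible apply pow_mem))
  have he : (2 * (qf 0 1 * qf 0 3 * qf 2 2 + qf 1 2 * qf 2 3 * qf 0 0)) ∈ Qalg := by
    (repeat' (first
      | with_reducible assumption | with_reducible exact Qs _ | with_reducible exact Qq01 | with_reducible exact Qq12 | with_reducible exact Qq23 | with_reducible exact Qq03 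
      | with_reducible exact Q2 | with_reducible exact Q4 | with_reducible exact Q16 | with_reducible apply add_mem 
      | with_reducible apply sub_mem | with_reducible apply mul_mem | with_reducible apply neg_mem | with_reducible apply pow_mem))
  have hk : (qf 0 0 * qf 1 1 * qf 2 2 * qf 3 3 - qf 0 1 ^ 2 * qf 2 2 * qf 3 3
      - qf 1 2 ^ 2 * qf 0 0 * qf 3 3 - qf 2 3 ^ 2 * qf 0 0 * qf 1 1 - qf 0 3 ^ 2 * qf 1 1 * qf 2 2
      + qf 0 1 ^ 2 * qf 2 3 ^ 2 + qf 0 3 ^ 2 * qf 1 2 ^ 2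
      - 2 * (qf 0 1 * qf 1 2 * qf 2 3 * qf 0 3)) ∈ Qalg := by
    (repeat' (first
      | with_reducible assumption | with_reducible exact Qs _ | with_reducible exact Qq01 | with_reducible exact Qq12 | with_reducible exact Qq23 | with_reducible exact Qq03 
      | with_reducible exact Q2 | with_reducible exact Q4 | with_reducible exact Q16 | with_reducible apply add_mem 
      | with_reducible apply sub_mem | with_reducible apply mul_mem | with_reducible apply neg_mem | with_reducible apply pow_mem))
  generalize -(qf 1 1 * qf 3 3) = α at *
  generalize -(qf 0 0 * qf 2 2) = β at *
  generalize (-2 * (qf 0 3 * qf 1 2) - 2 * (qf 0 1 * qf 2 3)) = γ at *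
  generalize (2 * (qf 1 2 * qf 0 1 * qf 3 3 + qf 2 3 * qf 0 3 * qf 1 1)) = δ at *
  generalize (2 * (qf 0 1 * qf 0 3 * qf 2 2 + qf 1 2 * qf 2 3 * qf 0 0)) = η at *
  generalize (qf 0 0 * qf 1 1 * qf 2 2 * qf 3 3 - qf 0 1 ^ 2 * qf 2 2 * qf 3 3
      - qf 1 2 ^ 2 * qf 0 0 * qf 3 3 - qf 2 3 ^ 2 * qf 0 0 * qf 1 1 - qf 0 3 ^ 2 * qf 1 1 * qf 2 2
      + qf 0 1 ^ 2 * qf 2 3 ^ 2 + qf 0 3 ^ 2 * qf 1 2 ^ 2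
      - 2 * (qf 0 1 * qf 1 2 * qf 2 3 * qf 0 3)) = κ at *
  have hs : tr1 0 * tr1 2 ∈ Qalg := mul_mem (Q1 _) (Q1 _)
  have hr : tr1 1 * tr1 3 ∈ Qalg := mul_mem (Q1 _) (Q1 _)
  unfold qf at h
  generalize tr1 0 * tr1 2 = s at *
  generalize tr1 1 * tr1 3 = r at *
  refine ⟨16 * r, 16 * s, -(4 * r ^ 2 + 4 * α), -(4 * s ^ 2 + 4 * β), -(16 * (s * r) + 4 * γ),
    4 * (s * r ^ 2) + 4 * (s * α) + 2 * (γ * r) - 2 * δ,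
    4 * (r * s ^ 2) + 4 * (r * β) + 2 * (γ * s) - 2 * η,
    -(s ^ 2 * r ^ 2 + α * s ^ 2 + β * r ^ 2 + γ * s * r - δ * s - η * r + κ),
    ⟨?_, ?_, ?_, ?_, ?_, ?_, ?_, ?_⟩, ?_⟩
  rotate_left 8
  · linear_combination h
  all_goals (repeat' (first
      | with_reducible assumption | with_reducible exact Qs _ | with_reducible exact Qq01 | with_reducible exact Qq12 | with_reducible exact Qq23 | with_reducible exact Qq03 
      | with_reducible exact Q2 | with_reducible exact Q4 | with_reducible exact Q16 | with_reducible apply add_mem 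
      | with_reducible apply sub_mem | with_reducible apply mul_mem | with_reducible apply neg_mem | with_reducible apply pow_mem))

lemma xz_mem : ∀ d a b : ℕ, a + b = d → tr2 0 2 ^ a * tr2 1 3 ^ b ∈ NB := by
  intro d
  induction d using Nat.strong_induction_on with
  | _ d ih =>
    intro a b hab
    rcases b with _ | _ | b
    · simpa [al, bv, wv] using al_mem (0, a)
    · simpa [al, bv, wv] using al_mem (1, a)
    rcases a with _ | _ | a
    · have := al_mem (4, b)
      simp [al, bv, wv] at this ⊢
      convert this using 1; ring
    · have := al_mem (5, b)
      simp [al, bv, wv] at this ⊢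
      convert this using 1; ring
    obtain ⟨c21, c12, c20, c02, c11, c10, c01, c00, ⟨h21, h12, h20, h02, h11, h10, h01, h00⟩, h⟩ :=
      rel22
    apply of_num_mul NB 16
    have e : ((16 : ℕ) : Fn) * (tr2 0 2 ^ (a + 1 + 1) * tr2 1 3 ^ (b + 1 + 1)) =
        c21 * (tr2 0 2 ^ (a + 2) * tr2 1 3 ^ (b + 1)) + c12 * (tr2 0 2 ^ (a + 1) * tr2 1 3 ^ (b + 2))
        + c20 * (tr2 0 2 ^ (a + 2) * tr2 1 3 ^ b) + c02 * (tr2 0 2 ^ a * tr2 1 3 ^ (b + 2))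
        + c11 * (tr2 0 2 ^ (a + 1) * tr2 1 3 ^ (b + 1)) + c10 * (tr2 0 2 ^ (a + 1) * tr2 1 3 ^ b)
        + c01 * (tr2 0 2 ^ a * tr2 1 3 ^ (b + 1)) + c00 * (tr2 0 2 ^ a * tr2 1 3 ^ b) := by
      push_cast
      linear_combination (tr2 0 2 ^ a * tr2 1 3 ^ b) * h
    rw [e]
    have hm : ∀ c ∈ Qalg, ∀ a' b' : ℕ, a' + b' < d → c * (tr2 0 2 ^ a' * tr2 1 3 ^ b') ∈ NB :=
      fun c hc a' b' hd => NB_Q c hc _ (ih _ hd a' b' rfl)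
    exact NB.add_mem (NB.add_mem (NB.add_mem (NB.add_mem (NB.add_mem (NB.add_mem (NB.add_mem
      (hm _ h21 _ _ (by omega)) (hm _ h12 _ _ (by omega))) (hm _ h20 _ _ (by omega)))
      (hm _ h02 _ _ (by omega))) (hm _ h11 _ _ (by omega))) (hm _ h10 _ _ (by omega)))
      (hm _ h01 _ _ (by omega))) (hm _ h00 _ _ (by omega))

noncomputable def Pal : Subalgebra ℂ Fn :=
  Algebra.adjoin ℂ ({tr1 0, tr1 1, tr1 2, tr1 3, tr2 0 1, tr2 1 2, tr2 2 3, tr2 0 3} ∪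
    {tr2 0 2, tr2 1 3})

lemma Q_le_P : Qalg ≤ Pal := Algebra.adjoin_mono Set.subset_union_left

/-- `Pal · w ⊆ NB` as soon as all `t₁₃ᵃ t₂₄ᵇ w` lie in `NB`. -/
lemma P_mul_mem (w : Fn) (hw : ∀ a b : ℕ, tr2 0 2 ^ a * tr2 1 3 ^ b * w ∈ NB) (p : Fn)
    (hp : p ∈ Pal) : p * w ∈ NB := by
  let T : Submodule ℂ Fn := Submodule.span ℂ
    {f | ∃ q ∈ Qalg, ∃ a b : ℕ, f = q * (tr2 0 2 ^ a * tr2 1 3 ^ b * w)}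
  have key : ∀ s : Fn, (∀ q ∈ Qalg, ∀ a b : ℕ, s * (q * (tr2 0 2 ^ a * tr2 1 3 ^ b * w)) ∈ T) →
      ∀ n ∈ T, s * n ∈ T := by
    intro s hs n hn
    induction hn using Submodule.span_induction with
    | mem x hx =>
      obtain ⟨q, hq, a, b, rfl⟩ := hx
      exact hs q hq a b
    | zero => rw [mul_zero]; exact T.zero_mem
    | add x y _ _ hx hy => rw [mul_add]; exact T.add_mem hx hy
    | smul c x _ hx => rw [mul_smul_comm]; exact T.smul_mem c hx
  have hT : ∀ n ∈ T, p * n ∈ T := by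
    refine adjoin_mul_mem _ T ?_ p hp
    rintro s (hs | rfl | rfl)
    · exact key s fun q hq a b => Submodule.subset_span
        ⟨s * q, mul_mem (Algebra.subset_adjoin hs) hq, a, b, by ring⟩
    · exact key _ fun q hq a b => Submodule.subset_span ⟨q, hq, a + 1, b, by ring⟩
    · exact key _ fun q hq a b => Submodule.subset_span ⟨q, hq, a, b + 1, by ring⟩
  have hle : T ≤ NB := by
    apply Submodule.span_le.mpr
    rintro f ⟨q, hq, a, b, rfl⟩
    exact NB_Q q hq _ (hw a b)
  exact hle (hT w (Submodule.subset_span ⟨1, one_mem _, 0, 0, by simp⟩))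

lemma P_le (p : Fn) (hp : p ∈ Pal) : p ∈ NB := by
  have := P_mul_mem 1 (fun a b => by rw [mul_one]; exact xz_mem _ a b rfl) p hp
  rwa [mul_one] at this

lemma Pm1 (i : Fin 4) : tr1 i ∈ Pal := Q_le_P (Q1 i)

lemma Pm2 (i j : Fin 4) : tr2 i j ∈ Pal := by
  have hd : ∀ i, tr2 i i ∈ Pal := by
    intro i
    have h := qf_self i
    unfold qf at h
    have h2 : tr2 i i = tr1 i ^ 2 - 2 := by
      funext ρ
      have := congrFun h ρ
      simp only [Pi.mul_apply, Pi.sub_apply, Pi.pow_apply, Pi.ofNat_apply] at this ⊢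
      linear_combination this / 2
    rw [h2]
    exact sub_mem (pow_mem (Pm1 i) 2) (Q_le_P Q2)
  have h02 : tr2 0 2 ∈ Pal := Algebra.subset_adjoin (by right; simp)
  have h13 : tr2 1 3 ∈ Pal := Algebra.subset_adjoin (by right; simp)
  have h01 := Q_le_P Q01
  have h12 := Q_le_P Q12
  have h23 := Q_le_P Q23
  have h03 := Q_le_P Q03
  have hc : ∀ i : Fin 4, i = 0 ∨ i = 1 ∨ i = 2 ∨ i = 3 := by decide
  rcases hc i with rfl | rfl | rfl | rfl <;> rcases hc j with rfl | rfl | rfl | rfl <;> first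
    | with_reducible exact hd _
    | with_reducible assumption
    | (rw [tr2_symm]; with_reducible assumption)

lemma Pqf (i j : Fin 4) : qf i j ∈ Pal :=
  sub_mem (mul_mem (Q_le_P Q2) (Pm2 i j)) (mul_mem (Pm1 i) (Pm1 j))

lemma Pef (i j k : Fin 4) : ef i j k ∈ Pal :=
  sub_mem (add_mem (add_mem (mul_mem (Pm1 i) (Pm2 j k)) (mul_mem (Pm1 j) (Pm2 i k)))
    (mul_mem (Pm1 k) (Pm2 i j))) (mul_mem (mul_mem (Pm1 i) (Pm1 j)) (Pm1 k))

lemma step (m y w w1 w2 w3 c0 c1 c2 c3 p : Fn)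
    (h : 4 * (y * w) = 2 * (c0 * w) + 2 * (c1 * w1) + 2 * (c2 * w2) + 2 * (c3 * w3) + p)
    (h0 : c0 ∈ Qalg) (h1 : c1 ∈ Qalg) (h2 : c2 ∈ Qalg) (h3 : c3 ∈ Qalg) (hp : p ∈ Pal)
    (hm : m ∈ Pal) (hw : m * w ∈ NB) (hw1 : m * w1 ∈ NB) (hw2 : m * w2 ∈ NB) (hw3 : m * w3 ∈ NB) :
    m * y * w ∈ NB := by
  apply of_num_mul NB 4
  have e : ((4 : ℕ) : Fn) * (m * y * w) = 2 * (c0 * (m * w)) + 2 * (c1 * (m * w1))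
      + 2 * (c2 * (m * w2)) + 2 * (c3 * (m * w3)) + m * p := by
    push_cast
    linear_combination m * h
  rw [e]
  have k : ∀ c ∈ Qalg, ∀ n ∈ NB, 2 * (c * n) ∈ NB := fun c hc n hn =>
    NB_Q _ Q2 _ (NB_Q c hc n hn)
  exact NB.add_mem (NB.add_mem (NB.add_mem (NB.add_mem (k _ h0 _ hw) (k _ h1 _ hw1))
    (k _ h2 _ hw2)) (k _ h3 _ hw3)) (P_le _ (mul_mem hm hp))

lemma Pxz (a b : ℕ) : tr2 0 2 ^ a * tr2 1 3 ^ b ∈ Pal :=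
  mul_mem (pow_mem (Pm2 _ _) _) (pow_mem (Pm2 _ _) _)

lemma W_mem : ∀ d a b : ℕ, a + b = d →
    tr2 0 2 ^ a * tr2 1 3 ^ b * tr3 0 1 2 ∈ NB ∧ tr2 0 2 ^ a * tr2 1 3 ^ b * tr3 0 2 3 ∈ NB ∧
    tr2 0 2 ^ a * tr2 1 3 ^ b * tr3 0 1 3 ∈ NB ∧ tr2 0 2 ^ a * tr2 1 3 ^ b * tr3 1 2 3 ∈ NB := by
  intro d
  induction d with
  | zero =>
    intro a b hab
    obtain rfl : a = 0 := by omega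
    obtain rfl : b = 0 := by omega
    refine ⟨?_, ?_, ?_, ?_⟩
    · simpa [al, bv, wv] using al_mem (2, 0)
    · simpa [al, bv, wv] using al_mem (3, 0)
    · simpa [al, bv, wv] using al_mem (6, 0)
    · simpa [al, bv, wv] using al_mem (7, 0)
  | succ d ih =>
    intro a b hab
    have q01 := Qq01
    have q12 := Qq12
    have q23 := Qq23
    have q03 := Qq03
    have hr : tr1 1 * tr1 3 ∈ Qalg := mul_mem (Q1 _) (Q1 _)
    have hs : tr1 0 * tr1 2 ∈ Qalg := mul_mem (Q1 _) (Q1 _)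
    refine ⟨?_, ?_, ?_, ?_⟩
    · rcases b with _ | b
      · simpa [al, bv, wv] using al_mem (2, a)
      · obtain ⟨i1, i2, i3, i4⟩ := ih a b (by omega)
        have h := qf_df 1 0 1 2 3
        rw [qf_symm 1 0] at h
        rw [pow_succ, ← mul_assoc]
        refine step _ _ _ (tr3 1 2 3) (tr3 0 2 3) (tr3 0 1 3) (tr1 1 * tr1 3) (qf 0 1) (-qf 1 1)
          (qf 1 2) (qf 1 3 * ef 0 1 2 - qf 0 1 * ef 1 2 3 + qf 1 1 * ef 0 2 3 - qf 1 2 * ef 0 1 3)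
          ?_ hr q01 (neg_mem (Qs _)) q12 ?_ (Pxz a b) i1 i4 i2 i3
        · have e : qf 1 3 = 2 * tr2 1 3 - tr1 1 * tr1 3 := rfl
          unfold df at h
          linear_combination -h - 2 * tr3 0 1 2 * e
        · exact sub_mem (add_mem (sub_mem (mul_mem (Pqf _ _) (Pef _ _ _))
            (mul_mem (Pqf _ _) (Pef _ _ _))) (mul_mem (Pqf _ _) (Pef _ _ _)))
            (mul_mem (Pqf _ _) (Pef _ _ _))
    · rcases b with _ | b
      · simpa [al, bv, wv] using al_mem (3, a)
      · obtain ⟨i1, i2, i3, i4⟩ := ih a b (by omega)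
        have h := qf_df 3 0 1 2 3
        rw [qf_symm 3 0, qf_symm 3 1, qf_symm 3 2] at h
        rw [pow_succ, ← mul_assoc]
        refine step _ _ _ (tr3 1 2 3) (tr3 0 1 2) (tr3 0 1 3) (tr1 1 * tr1 3) (qf 0 3) (-qf 3 3)
          (qf 2 3) (qf 1 3 * ef 0 2 3 - qf 0 3 * ef 1 2 3 + qf 3 3 * ef 0 1 2 - qf 2 3 * ef 0 1 3)
          ?_ hr q03 (neg_mem (Qs _)) q23 ?_ (Pxz a b) i2 i4 i1 i3
        · have e : qf 1 3 = 2 * tr2 1 3 - tr1 1 * tr1 3 := rfl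
          unfold df at h
          linear_combination -h - 2 * tr3 0 2 3 * e
        · exact sub_mem (add_mem (sub_mem (mul_mem (Pqf _ _) (Pef _ _ _))
            (mul_mem (Pqf _ _) (Pef _ _ _))) (mul_mem (Pqf _ _) (Pef _ _ _)))
            (mul_mem (Pqf _ _) (Pef _ _ _))
    · rcases a with _ | a
      · simpa [al, bv, wv] using al_mem (6, b)
      · obtain ⟨i1, i2, i3, i4⟩ := ih a b (by omega)
        have h := qf_df 0 0 1 2 3
        rw [pow_succ, mul_right_comm (tr2 0 2 ^ a)]
        refine step _ _ _ (tr3 0 2 3) (tr3 1 2 3) (tr3 0 1 2) (tr1 0 * tr1 2) (qf 0 1) (-qf 0 0)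
          (qf 0 3) (qf 0 2 * ef 0 1 3 - qf 0 1 * ef 0 2 3 + qf 0 0 * ef 1 2 3 - qf 0 3 * ef 0 1 2)
          ?_ hs q01 (neg_mem (Qs _)) q03 ?_ (Pxz a b) i3 i2 i4 i1
        · have e : qf 0 2 = 2 * tr2 0 2 - tr1 0 * tr1 2 := rfl
          unfold df at h
          linear_combination h - 2 * tr3 0 1 3 * e
        · exact sub_mem (add_mem (sub_mem (mul_mem (Pqf _ _) (Pef _ _ _))
            (mul_mem (Pqf _ _) (Pef _ _ _))) (mul_mem (Pqf _ _) (Pef _ _ _)))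
            (mul_mem (Pqf _ _) (Pef _ _ _))
    · rcases a with _ | a
      · simpa [al, bv, wv] using al_mem (7, b)
      · obtain ⟨i1, i2, i3, i4⟩ := ih a b (by omega)
        have h := qf_df 2 0 1 2 3
        rw [qf_symm 2 0, qf_symm 2 1] at h
        rw [pow_succ, mul_right_comm (tr2 0 2 ^ a)]
        refine step _ _ _ (tr3 0 2 3) (tr3 0 1 3) (tr3 0 1 2) (tr1 0 * tr1 2) (qf 1 2) (-qf 2 2)
          (qf 2 3) (qf 0 2 * ef 1 2 3 - qf 1 2 * ef 0 2 3 + qf 2 2 * ef 0 1 3 - qf 2 3 * ef 0 1 2)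
          ?_ hs q12 (neg_mem (Qs _)) q23 ?_ (Pxz a b) i4 i2 i3 i1
        · have e : qf 0 2 = 2 * tr2 0 2 - tr1 0 * tr1 2 := rfl
          unfold df at h
          linear_combination h - 2 * tr3 1 2 3 * e
        · exact sub_mem (add_mem (sub_mem (mul_mem (Pqf _ _) (Pef _ _ _))
            (mul_mem (Pqf _ _) (Pef _ _ _))) (mul_mem (Pqf _ _) (Pef _ _ _)))
            (mul_mem (Pqf _ _) (Pef _ _ _))

/-- the increasing triple traces -/
def Wset : Set Fn := {f | ∃ i j k : Fin 4, i < j ∧ j < k ∧ f = tr3 i j k}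

lemma W_cases : ∀ i j k : Fin 4, i < j → j < k → (i = 0 ∧ j = 1 ∧ k = 2) ∨ (i = 0 ∧ j = 2 ∧ k = 3) ∨
    (i = 0 ∧ j = 1 ∧ k = 3) ∨ (i = 1 ∧ j = 2 ∧ k = 3) := by
  decide

lemma PW_mem (p w : Fn) (hp : p ∈ Pal) (hw : w ∈ Wset) : p * w ∈ NB := by
  obtain ⟨i, j, k, h1, h2, rfl⟩ := hw
  apply P_mul_mem _ _ p hp
  intro a b
  obtain ⟨k1, k2, k3, k4⟩ := W_mem _ a b rfl
  rcases W_cases i j k h1 h2 with ⟨rfl, rfl, rfl⟩ | ⟨rfl, rfl, rfl⟩ | ⟨rfl, rfl, rfl⟩ |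
    ⟨rfl, rfl, rfl⟩ <;> assumption

noncomputable def TT : Submodule ℂ Fn :=
  Submodule.span ℂ {f | ∃ p ∈ Pal, f = p ∨ ∃ w ∈ Wset, f = p * w}

lemma TT_le : TT ≤ NB := by
  apply Submodule.span_le.mpr
  rintro f ⟨p, hp, rfl | ⟨w, hw, rfl⟩⟩
  · exact P_le _ hp
  · exact PW_mem p w hp hw

lemma TT_P (p : Fn) (hp : p ∈ Pal) : p ∈ TT := Submodule.subset_span ⟨p, hp, Or.inl rfl⟩
lemma TT_PW (p w : Fn) (hp : p ∈ Pal) (hw : w ∈ Wset) : p * w ∈ TT :=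
  Submodule.subset_span ⟨p, hp, Or.inr ⟨w, hw, rfl⟩⟩

lemma TT_key (s : Fn) (h1 : ∀ p ∈ Pal, s * p ∈ TT) (h2 : ∀ p ∈ Pal, ∀ w ∈ Wset, s * (p * w) ∈ TT) :
    ∀ n ∈ TT, s * n ∈ TT := by
  intro n hn
  induction hn using Submodule.span_induction with
  | mem x hx =>
    obtain ⟨p, hp, rfl | ⟨w, hw, rfl⟩⟩ := hx
    · exact h1 _ hp
    · exact h2 p hp w hw
  | zero => rw [mul_zero]; exact TT.zero_mem
  | add x y _ _ hx hy => rw [mul_add]; exact TT.add_mem hx hy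
  | smul c x _ hx => rw [mul_smul_comm]; exact TT.smul_mem c hx

lemma TT_mulP (s : Fn) (hs : s ∈ Pal) : ∀ n ∈ TT, s * n ∈ TT :=
  TT_key s (fun p hp => TT_P _ (mul_mem hs hp)) (fun p hp w hw => by
    rw [← mul_assoc]; exact TT_PW _ _ (mul_mem hs hp) hw)

lemma TT_mulW (s : Fn) (hs : s ∈ Wset) : ∀ n ∈ TT, s * n ∈ TT := by
  apply TT_key
  · intro p hp
    rw [mul_comm]; exact TT_PW _ _ hp hs
  · intro p hp w hw
    have hs2 := hs
    have hw2 := hw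
    obtain ⟨i, j, k, _, _, rfl⟩ := hs2
    obtain ⟨l, m, n, _, _, rfl⟩ := hw2
    have h := df_mul i j k l m n
    have hdet : (qf i l * (qf j m * qf k n - qf j n * qf k m)
      - qf i m * (qf j l * qf k n - qf j n * qf k l)
      + qf i n * (qf j l * qf k m - qf j m * qf k l)) ∈ Pal :=
      add_mem (sub_mem
        (mul_mem (Pqf _ _) (sub_mem (mul_mem (Pqf _ _) (Pqf _ _)) (mul_mem (Pqf _ _) (Pqf _ _))))
        (mul_mem (Pqf _ _) (sub_mem (mul_mem (Pqf _ _) (Pqf _ _)) (mul_mem (Pqf _ _) (Pqf _ _)))))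
        (mul_mem (Pqf _ _) (sub_mem (mul_mem (Pqf _ _) (Pqf _ _)) (mul_mem (Pqf _ _) (Pqf _ _))))
    generalize (qf i l * (qf j m * qf k n - qf j n * qf k m)
      - qf i m * (qf j l * qf k n - qf j n * qf k l)
      + qf i n * (qf j l * qf k m - qf j m * qf k l)) = D at h hdet
    have he := Pef i j k
    have he' := Pef l m n
    have h8 : (8 : Fn) ∈ Pal := ofNat_mem Pal 8
    have h4 : (4 : Fn) ∈ Pal := ofNat_mem Pal 4
    unfold df at h
    generalize ef i j k = e1 at *
    generalize ef l m n = e2 at *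
    apply of_num_mul TT 16
    have e : ((16 : ℕ) : Fn) * (tr3 i j k * (p * tr3 l m n)) =
        (p * (8 * e2)) * tr3 i j k + (p * (8 * e1)) * tr3 l m n + p * (-D - 4 * (e1 * e2)) := by
      push_cast
      linear_combination p * h
    rw [e]
    exact TT.add_mem (TT.add_mem (TT_PW _ _ (mul_mem hp (mul_mem h8 he')) hs)
      (TT_PW _ _ (mul_mem hp (mul_mem h8 he)) hw))
      (TT_P _ (mul_mem hp (sub_mem (neg_mem hdet) (mul_mem h4 (mul_mem he he')))))

lemma X_le : Subalgebra.toSubmodule Xalg ≤ NB := by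
  intro f hf
  have hf' : f ∈ Xalg := hf
  apply TT_le
  rw [← mul_one f]
  refine adjoin_mul_mem _ TT ?_ f hf' 1 (TT_P _ (one_mem _))
  rintro s (⟨i, rfl⟩ | ⟨i, j, _, rfl⟩ | ⟨i, j, k, h1, h2, rfl⟩ | rfl)
  · exact TT_mulP _ (Pm1 i)
  · exact TT_mulP _ (Pm2 i j)
  · exact TT_mulW _ ⟨i, j, k, h1, h2, rfl⟩
  · intro n hn
    apply of_num_mul TT 2
    have e : ((2 : ℕ) : Fn) * (tr4 * n) = tr1 0 * (tr3 1 2 3 * n) + tr1 1 * (tr3 0 2 3 * n)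
        + tr1 2 * (tr3 0 1 3 * n) + tr1 3 * (tr3 0 1 2 * n)
        + (tr2 0 1 * (tr2 2 3 * n) - tr2 0 2 * (tr2 1 3 * n) + tr2 0 3 * (tr2 1 2 * n)
    - tr1 0 * (tr1 1 * (tr2 2 3 * n)) - tr1 0 * (tr1 3 * (tr2 1 2 * n))
    - tr1 1 * (tr1 2 * (tr2 0 3 * n))
    - tr1 2 * (tr1 3 * (tr2 0 1 * n)) + tr1 0 * (tr1 1 * (tr1 2 * (tr1 3 * n)))) := by
      push_cast
      linear_combination n * tr4_eq
    have m1 : ∀ i, ∀ n ∈ TT, tr1 i * n ∈ TT := fun i => TT_mulP _ (Pm1 i)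
    have m2 : ∀ i j, ∀ n ∈ TT, tr2 i j * n ∈ TT := fun i j => TT_mulP _ (Pm2 i j)
    have m3 : ∀ i j k, i < j → j < k → ∀ n ∈ TT, tr3 i j k * n ∈ TT :=
      fun i j k h1 h2 => TT_mulW _ ⟨i, j, k, h1, h2, rfl⟩
    rw [e]
    refine TT.add_mem (TT.add_mem (TT.add_mem (TT.add_mem (m1 _ _ (m3 _ _ _ ?_ ?_ _ hn))
      (m1 _ _ (m3 _ _ _ ?_ ?_ _ hn))) (m1 _ _ (m3 _ _ _ ?_ ?_ _ hn)))
      (m1 _ _ (m3 _ _ _ ?_ ?_ _ hn))) ?_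
    rotate_right 1
    · exact TT.add_mem (TT.sub_mem (TT.sub_mem (TT.sub_mem (TT.sub_mem (TT.add_mem (TT.sub_mem
        (m2 _ _ _ (m2 _ _ _ hn)) (m2 _ _ _ (m2 _ _ _ hn))) (m2 _ _ _ (m2 _ _ _ hn)))
        (m1 _ _ (m1 _ _ (m2 _ _ _ hn)))) (m1 _ _ (m1 _ _ (m2 _ _ _ hn))))
        (m1 _ _ (m1 _ _ (m2 _ _ _ hn)))) (m1 _ _ (m1 _ _ (m2 _ _ _ hn))))
        (m1 _ _ (m1 _ _ (m1 _ _ (m1 _ _ hn))))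
    all_goals decide

lemma X1 (i : Fin 4) : tr1 i ∈ Xalg := Algebra.subset_adjoin (Or.inl ⟨i, rfl⟩)
lemma X2 (i j : Fin 4) (h : i < j) : tr2 i j ∈ Xalg :=
  Algebra.subset_adjoin (Or.inr (Or.inl ⟨i, j, h, rfl⟩))
lemma X3 (i j k : Fin 4) (h : i < j) (h' : j < k) : tr3 i j k ∈ Xalg :=
  Algebra.subset_adjoin (Or.inr (Or.inr (Or.inl ⟨i, j, k, h, h', rfl⟩)))

lemma A_mem (a : Fn) (ha : a ∈ Aset) : a ∈ Xalg := by
  have x := X2 0 2 (by decide)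
  have z := X2 1 3 (by decide)
  rcases ha with ((rfl | rfl | rfl | rfl) | ⟨k, _, rfl | rfl | rfl | rfl⟩) |
    ⟨k, rfl | rfl | rfl | rfl⟩
  · exact one_mem _
  · exact x
  · exact z
  · exact mul_mem x z
  · exact pow_mem x k
  · exact mul_mem (pow_mem x k) z
  · exact pow_mem z k
  · exact mul_mem (pow_mem z k) x
  · exact mul_mem (pow_mem x k) (X3 _ _ _ (by decide) (by decide))
  · exact mul_mem (pow_mem x k) (X3 _ _ _ (by decide) (by decide))
  · exact mul_mem (pow_mem z k) (X3 _ _ _ (by decide) (by decide))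
  · exact mul_mem (pow_mem z k) (X3 _ _ _ (by decide) (by decide))

lemma NB_le : NB ≤ Subalgebra.toSubmodule Xalg := by
  apply Submodule.span_le.mpr
  rintro f ⟨⟨m, a, ha⟩, rfl⟩
  have h : Bfam (m, ⟨a, ha⟩) ∈ Xalg := by
    unfold Bfam
    exact mul_mem (mul_mem (mul_mem (mul_mem (mul_mem (mul_mem (mul_mem (mul_mem
      (pow_mem (X1 _) _) (pow_mem (X1 _) _)) (pow_mem (X1 _) _)) (pow_mem (X1 _) _))
      (pow_mem (X2 _ _ (by decide)) _)) (pow_mem (X2 _ _ (by decide)) _))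
      (pow_mem (X2 _ _ (by decide)) _)) (pow_mem (X2 _ _ (by decide)) _)) (A_mem a ha)
  exact h

lemma NB_eq : Submodule.span ℂ (Set.range Bfam) = Subalgebra.toSubmodule Xalg :=
  le_antisymm NB_le X_le

end S6

/-- The family `B` is a basis of `X` as a vector space over ℂ. -/
theorem stmt_6 :
    LinearIndependent ℂ Bfam ∧
    Submodule.span ℂ (Set.range Bfam) = Subalgebra.toSubmodule Xalg := by
  exact ⟨S6.Bfam_li, S6.NB_eq⟩
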